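/- If the orbit equivalence relation of every free Borel action of every polycyclic group on a standard Borel space is hyperfinite, then the orbit equivalence relation of every Borel action of every polycyclic group on a standard Borel space is hyperfinite. -/

import Mathlib

/-- An action of a group on a set, given by a map `a : G → X → X`. -/
def IsGroupAction {G X : Type*} [Group G] (a : G → X → X) : Prop :=
  (∀ x, a 1 x = x) ∧ ∀ g h x, a (g * h) x = a g (a h x)

/-- A group is polycyclic if it admits a finite subnormal series with cyclic factors. -/
def IsPolycyclic (G : Type*) [Group G] : Prop :=
  ∃ (n : ℕ) (H : Fin (n + 1) → Subgroup G),
    H 0 = ⊥ ∧ H (Fin.last n) = ⊤ ∧ Monotone H ∧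
    (∀ i : Fin n, ∀ g ∈ H i.succ, ∀ h ∈ H i.castSucc, g * h * g⁻¹ ∈ H i.castSucc) ∧
    (∀ i : Fin n, ∃ g ∈ H i.succ, ∀ h ∈ H i.succ, ∃ k : ℤ, h⁻¹ * g ^ k ∈ H i.castSucc)

/-- A finite Borel equivalence relation. -/
def IsFiniteBorelEquivRel {X : Type*} [MeasurableSpace X] (E : X → X → Prop) : Prop :=
  Equivalence E ∧ MeasurableSet {p : X × X | E p.1 p.2} ∧ ∀ x : X, {y | E x y}.Finite

/-- A Borel equivalence relation is hyperfinite if it is the increasing union of finite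
Borel equivalence relations. -/
def IsHyperfinite {X : Type*} [MeasurableSpace X] (E : X → X → Prop) : Prop :=
  ∃ F : ℕ → X → X → Prop,
    (∀ n, IsFiniteBorelEquivRel (F n)) ∧
    (∀ n x y, F n x y → F (n + 1) x y) ∧
    (∀ x y, E x y ↔ ∃ n, F n x y)

theorem IsPolycyclic.of_injective {G K : Type*} [Group G] [Group K] (hG : IsPolycyclic G)
    (f : K →* G) (hf : Function.Injective f) : IsPolycyclic K := by
  obtain ⟨n, H, hbot, htop, hmono, hnormal, hcyclic⟩ := hG
  refine ⟨n, fun i => (H i).comap f, ?_, ?_, fun i j hij => Subgroup.comap_mono (hmono hij),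
    fun i g hg h hh => ?_, fun i => ?_⟩
  · simp only [hbot]
    exact (MonoidHom.ker_eq_bot_iff f).2 hf
  · simp only [htop, Subgroup.comap_top]
  · simpa using hnormal i (f g) hg (f h) hh
  · let N : Subgroup (H i.succ) := (H i.castSucc).subgroupOf (H i.succ)
    have : N.Normal := ⟨fun h hh g => hnormal i g g.2 h hh⟩
    have : IsCyclic (H i.succ ⧸ N) := by
      obtain ⟨g, hg, hgen⟩ := hcyclic i
      refine ⟨⟨QuotientGroup.mk ⟨g, hg⟩, fun q => ?_⟩⟩
      obtain ⟨h, rfl⟩ := QuotientGroup.mk_surjective q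
      obtain ⟨k, hk⟩ := hgen h h.2
      refine ⟨k, ?_⟩
      change ((⟨g, hg⟩ ^ k : H i.succ) : H i.succ ⧸ N) = h
      exact (QuotientGroup.eq (s := N).2 hk).symm
    let φ : (H i.succ).comap f →* H i.succ ⧸ N :=
      (QuotientGroup.mk' N).comp (f.subgroupComap (H i.succ))
    obtain ⟨⟨_, g, rfl⟩, hgen⟩ := (inferInstance : IsCyclic φ.range).exists_generator
    refine ⟨g, g.2, fun h hh => ?_⟩
    obtain ⟨k, hk⟩ := hgen ⟨φ ⟨h, hh⟩, ⟨h, hh⟩, rfl⟩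
    refine ⟨k, ?_⟩
    have hφ : φ ⟨h, hh⟩ = φ (g ^ k) := by
      rw [map_zpow]
      exact (congrArg Subtype.val hk).symm
    have hmem : f.subgroupComap (H i.succ) (⟨h, hh⟩⁻¹ * g ^ k) ∈ N := by
      rw [map_mul, map_inv]
      exact QuotientGroup.eq.1 hφ
    exact hmem

theorem IsPolycyclic.of_surjective {G Q : Type*} [Group G] [Group Q] (hG : IsPolycyclic G)
    (f : G →* Q) (hf : Function.Surjective f) : IsPolycyclic Q := by
  obtain ⟨n, H, hbot, htop, hmono, hnormal, hcyclic⟩ := hG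
  refine ⟨n, fun i => (H i).map f, ?_, ?_, fun i j hij => Subgroup.map_mono (hmono hij), ?_,
    fun i => ?_⟩
  · simp only [hbot, Subgroup.map_bot]
  · simp only [htop, Subgroup.map_top_of_surjective f hf]
  · rintro i _ ⟨g, hg, rfl⟩ _ ⟨h, hh, rfl⟩
    exact ⟨_, hnormal i g hg h hh, by simp⟩
  · obtain ⟨g, hg, hgen⟩ := hcyclic i
    refine ⟨f g, ⟨g, hg, rfl⟩, ?_⟩
    rintro _ ⟨h, hh, rfl⟩
    obtain ⟨k, hk⟩ := hgen h hh
    exact ⟨k, _, hk, by simp⟩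

theorem IsPolycyclic.fg {G : Type*} [Group G] (hG : IsPolycyclic G) : Group.FG G := by
  obtain ⟨n, H, hbot, htop, hmono, -, hcyclic⟩ := hG
  have hfg : ∀ i, (H i).FG := by
    intro i
    induction i using Fin.induction with
    | zero => exact hbot ▸ Subgroup.FG.bot
    | succ i ih =>
      obtain ⟨g, hg, hgen⟩ := hcyclic i
      have hsup : H i.succ = H i.castSucc ⊔ Subgroup.zpowers g := by
        refine le_antisymm (fun h hh => ?_) (sup_le (hmono i.castSucc_lt_succ.le) ?_)
        · obtain ⟨k, hk⟩ := hgen h hh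
          have hmem : g ^ k * (h⁻¹ * g ^ k)⁻¹ ∈ H i.castSucc ⊔ Subgroup.zpowers g :=
            mul_mem (Subgroup.mem_sup_right ⟨k, rfl⟩) (inv_mem (Subgroup.mem_sup_left hk))
          simpa using hmem
        · rwa [Subgroup.zpowers_le]
      rw [hsup]
      exact ih.sup ⟨{g}, by simp [Subgroup.zpowers_eq_closure]⟩
  exact ⟨htop ▸ hfg (Fin.last n)⟩

theorem IsPolycyclic.countable {G : Type*} [Group G] (hG : IsPolycyclic G) : Countable G := by
  have := hG.fg
  obtain ⟨α, _, φ, hφ⟩ :=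
    Monoid.fg_iff_exists_freeGroup_hom_surjective_finite.1 (Group.fg_iff_monoid_fg.1 this)
  have : Countable (FreeMonoid α) := inferInstanceAs (Countable (List α))
  exact hφ.countable

/-- A polycyclic group has only countably many subgroups, since all of them are finitely
generated. -/
theorem IsPolycyclic.countable_subgroup {G : Type*} [Group G] (hG : IsPolycyclic G) :
    Countable (Subgroup G) := by
  have := hG.countable
  refine Function.Surjective.countable (f := fun S : Finset G => Subgroup.closure (S : Set G)) ?_
  intro H
  exact (Group.fg_iff_subgroup_fg H).1 (hG.of_injective H.subtype H.subtype_injective).fg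

/-- Suppose that `f` sends each point to an `E`-related one, that it sends `E`-related points into
the same one of countably many Borel pieces `{x | c x = i}`, and that `f` is finite-to-one on each
set `{x | r x ≤ n}`. If `E` is hyperfinite on each piece, then `E` is hyperfinite. -/
theorem IsHyperfinite.of_reduction {X ι : Type*} [MeasurableSpace X] [MeasurableEq X]
    [Countable ι] {E : X → X → Prop} (hE : Equivalence E) {c : X → ι}
    (hc : ∀ i, MeasurableSet {x | c x = i}) {f : X → X} (hf : Measurable f)
    {r : X → ℕ} (hr : Measurable r) (hEf : ∀ x, E x (f x))
    (hcf : ∀ x y, E x y → c (f x) = c (f y))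
    (hfin : ∀ n y, {x | f x = y ∧ r x ≤ n}.Finite)
    (hpiece : ∀ i, IsHyperfinite fun x y : {x // c x = i} => E x y) : IsHyperfinite E := by
  choose Φ hΦ hmono hunion using hpiece
  have hmono' : ∀ i x y, Monotone fun n => Φ i n x y := fun i x y =>
    monotone_nat_of_le_succ fun n => hmono i n x y
  refine ⟨fun n x y => x = y ∨ (r x ≤ n ∧ r y ≤ n ∧ ∃ i, ∃ (hx : c (f x) = i) (hy : c (f y) = i),
    Φ i n ⟨f x, hx⟩ ⟨f y, hy⟩), fun n => ⟨⟨fun x => Or.inl rfl, ?_, ?_⟩, ?_, fun x => ?_⟩, ?_, ?_⟩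
  · rintro x y (rfl | ⟨hx, hy, i, hxi, hyi, h⟩)
    · exact Or.inl rfl
    · exact Or.inr ⟨hy, hx, i, hyi, hxi, (hΦ i n).1.symm h⟩
  · rintro x y z (rfl | ⟨hx, hy, i, hxi, hyi, h⟩) hyz
    · exact hyz
    · obtain rfl | ⟨-, hz, j, hyj, hzj, h'⟩ := hyz
      · exact Or.inr ⟨hx, hy, i, hxi, hyi, h⟩
      · obtain rfl : i = j := hyi.symm.trans hyj
        exact Or.inr ⟨hx, hz, i, hxi, hzj, (hΦ i n).1.trans h h'⟩
  · have hset : {p : X × X | p.1 = p.2 ∨ (r p.1 ≤ n ∧ r p.2 ≤ n ∧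
        ∃ i, ∃ (hx : c (f p.1) = i) (hy : c (f p.2) = i), Φ i n ⟨f p.1, hx⟩ ⟨f p.2, hy⟩)} =
        {p | p.1 = p.2} ∪ ({p | r p.1 ≤ n} ∩ ({p | r p.2 ≤ n} ∩
          ⋃ i, Prod.map f f ⁻¹' (Prod.map Subtype.val Subtype.val ''
            {q : {x // c x = i} × {x // c x = i} | Φ i n q.1 q.2}))) := by
      ext ⟨x, y⟩
      simp
    rw [hset]
    refine (measurableSet_eq_fun measurable_fst measurable_snd).union
      ((measurableSet_le (hr.comp measurable_fst) measurable_const).inter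
        ((measurableSet_le (hr.comp measurable_snd) measurable_const).inter
          (MeasurableSet.iUnion fun i => (hf.prodMap hf) ?_)))
    have hemb := MeasurableEmbedding.subtype_coe (hc i)
    exact (hemb.prodMap hemb).measurableSet_image.2 (hΦ i n).2.1
  · refine ((Set.finite_singleton x).union
      ((((hΦ (c (f x)) n).2.2 ⟨f x, rfl⟩).image Subtype.val).biUnion fun z _ => hfin n z)).subset ?_
    rintro y (rfl | ⟨-, hy, i, rfl, hyi, h⟩)
    · exact Or.inl rfl
    · exact Or.inr (Set.mem_biUnion ⟨_, h, rfl⟩ ⟨rfl, hy⟩)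
  · rintro n x y (rfl | ⟨hx, hy, i, hxi, hyi, h⟩)
    · exact Or.inl rfl
    · exact Or.inr ⟨hx.trans n.le_succ, hy.trans n.le_succ, i, hxi, hyi, hmono i n _ _ h⟩
  · intro x y
    constructor
    · intro h
      obtain ⟨m, hm⟩ := (hunion (c (f y)) ⟨f x, hcf x y h⟩ ⟨f y, rfl⟩).1
        (hE.trans (hE.symm (hEf x)) (hE.trans h (hEf y)))
      exact ⟨max m (max (r x) (r y)), Or.inr ⟨by simp, by simp, _, hcf x y h, rfl,
        hmono' _ _ _ (le_max_left _ _) hm⟩⟩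
    · rintro ⟨n, rfl | ⟨-, -, i, hxi, hyi, h⟩⟩
      · exact hE.refl x
      · exact hE.trans (hEf x) (hE.trans ((hunion i _ _).2 ⟨n, h⟩) (hE.symm (hEf y)))

open MulAction

theorem measurableSet_stabilizer_eq {G X : Type*} [Group G] [Countable G] [MeasurableSpace X]
    [MeasurableEq X] [MulAction G X] [MeasurableConstSMul G X] (H : Subgroup G) :
    MeasurableSet {x : X | stabilizer G x = H} := by
  have hset : {x : X | stabilizer G x = H} = ⋂ g : G, {x | g • x = x ↔ g ∈ H} := by
    ext x
    simp [SetLike.ext_iff]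
  rw [hset]
  refine MeasurableSet.iInter fun g => ?_
  exact (measurableSet_eq_fun (measurable_const_smul g) measurable_id).iff (.const _)

/-- The normalizer of `H` acts on the set of points with stabilizer `H`. -/
@[reducible]
def normalizerMulAction {G X : Type*} [Group G] [MulAction G X] (H : Subgroup G) :
    MulAction (Subgroup.normalizer (H : Set G)) {x : X // stabilizer G x = H} where
  smul g x := ⟨(g : G) • x.1, by
    rw [stabilizer_smul_eq_stabilizer_map_conj, x.2]
    exact Subgroup.mem_normalizer_iff_map_conj_eq.1 g.2⟩
  one_smul x := Subtype.ext (one_smul G x.1)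
  mul_smul g h x := Subtype.ext (mul_smul (g : G) (h : G) x.1)

/-- A subgroup-dependent choice of conjugators which brings conjugate subgroups to a common
conjugate. -/
theorem exists_conjugator (G : Type*) [Group G] : ∃ τ : Subgroup G → G, ∀ (H : Subgroup G) (g : G),
    (H.map (MulAut.conj g).toMonoidHom).map
      (MulAut.conj (τ (H.map (MulAut.conj g).toMonoidHom))).toMonoidHom =
    H.map (MulAut.conj (τ H)).toMonoidHom := by
  have hmul : ∀ (H : Subgroup G) (g h : G), (H.map (MulAut.conj g).toMonoidHom).map
      (MulAut.conj h).toMonoidHom = H.map (MulAut.conj (h * g)).toMonoidHom := by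
    intro H g h
    rw [Subgroup.map_map, map_mul]
    rfl
  have hone : ∀ H : Subgroup G, H.map (MulAut.conj (1 : G)).toMonoidHom = H := by
    intro H
    rw [map_one]
    exact Subgroup.map_id H
  let s : Setoid (Subgroup G) :=
    { r := fun H K => ∃ g : G, H.map (MulAut.conj g).toMonoidHom = K
      iseqv := by
        refine ⟨fun H => ⟨1, hone H⟩, ?_, ?_⟩
        · rintro H _ ⟨g, rfl⟩
          exact ⟨g⁻¹, by rw [hmul, inv_mul_cancel, hone]⟩
        · rintro H _ _ ⟨g, rfl⟩ ⟨h, rfl⟩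
          exact ⟨h * g, (hmul H g h).symm⟩ }
  have hout : ∀ H : Subgroup G, ∃ g : G,
      H.map (MulAut.conj g).toMonoidHom = (Quotient.mk s H).out :=
    fun H => s.symm (Quotient.mk_out H)
  choose τ hτ using hout
  refine ⟨τ, fun H g => ?_⟩
  rw [hτ, hτ, Quotient.sound (s := s) (show s.r H _ from ⟨g, rfl⟩)]

/-- On the points with stabilizer `H`, the orbit equivalence relation is induced by a free action
of the quotient of the normalizer of `H` by `H`. -/
theorem isHyperfinite_stabilizer_eq
    (hfreecase : ∀ (G : Type) [Group G], IsPolycyclic G →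
      ∀ (X : Type) [MeasurableSpace X], StandardBorelSpace X →
      ∀ a : G → X → X, IsGroupAction a → (∀ g, Measurable (a g)) →
      (∀ g x, a g x = x → g = 1) →
      IsHyperfinite fun x y => ∃ g, a g x = y)
    {G X : Type} [Group G] (hG : IsPolycyclic G) [MeasurableSpace X] [StandardBorelSpace X]
    [MulAction G X] [MeasurableConstSMul G X] (H : Subgroup G) :
    IsHyperfinite fun x y : {x : X // stabilizer G x = H} => ∃ g : G, g • x.1 = y.1 := by
  have := hG.countable
  let N := Subgroup.normalizer (H : Set G)
  let _ : MulAction N {x : X // stabilizer G x = H} := normalizerMulAction H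
  have hker : H.subgroupOf N ≤ (toPermHom N {x : X // stabilizer G x = H}).ker := by
    intro g hg
    refine Equiv.ext fun x => Subtype.ext ?_
    exact mem_stabilizer_iff.1 (x.2.symm ▸ hg : (g : G) ∈ stabilizer G x.1)
  let ρ : N ⧸ H.subgroupOf N →* Equiv.Perm {x : X // stabilizer G x = H} :=
    QuotientGroup.lift _ _ hker
  have hQ : IsPolycyclic (N ⧸ H.subgroupOf N) :=
    (hG.of_injective N.subtype N.subtype_injective).of_surjective
      (QuotientGroup.mk' _) (QuotientGroup.mk'_surjective _)
  have hfree := hfreecase (N ⧸ H.subgroupOf N) hQ {x : X // stabilizer G x = H}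
    (measurableSet_stabilizer_eq H).standardBorel (fun q x => ρ q x)
    ⟨fun x => by simp, fun g h x => by simp⟩ ?_ ?_
  · convert hfree using 3 with x y
    constructor
    · rintro ⟨g, hg⟩
      have hgN : g ∈ N := by
        rw [Subgroup.mem_normalizer_iff_map_conj_eq]
        have h := stabilizer_smul_eq_stabilizer_map_conj g x.1
        rw [hg, x.2, y.2] at h
        exact h.symm
      exact ⟨QuotientGroup.mk ⟨g, hgN⟩, Subtype.ext hg⟩
    · rintro ⟨q, hq⟩
      obtain ⟨g, rfl⟩ := QuotientGroup.mk_surjective q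
      exact ⟨g, congrArg Subtype.val hq⟩
  · intro q
    obtain ⟨g, rfl⟩ := QuotientGroup.mk_surjective q
    exact ((measurable_const_smul (g : G)).comp measurable_subtype_coe).subtype_mk
  · intro q x hq
    obtain ⟨g, rfl⟩ := QuotientGroup.mk_surjective q
    rw [QuotientGroup.eq_one_iff, Subgroup.mem_subgroupOf]
    exact x.2 ▸ mem_stabilizer_iff.2 (congrArg Subtype.val hq)

/-- If `G` has countably many subgroups, hyperfiniteness of the orbit equivalence relation can be
checked on each set of points with a given stabilizer. -/
theorem isHyperfinite_orbit_of_countable_subgroup {G X : Type*} [Group G] [Countable G]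
    [Countable (Subgroup G)] [MeasurableSpace X] [MeasurableEq X] [MulAction G X]
    [MeasurableConstSMul G X]
    (h : ∀ H : Subgroup G,
      IsHyperfinite fun x y : {x : X // stabilizer G x = H} => ∃ g : G, g • x.1 = y.1) :
    IsHyperfinite fun x y : X => ∃ g : G, g • x = y := by
  obtain ⟨τ, hτ⟩ := exists_conjugator G
  obtain ⟨e, he⟩ := exists_injective_nat G
  let _ : MeasurableSpace (Subgroup G) := ⊤
  let _ : MeasurableSpace G := ⊤
  have hstab : Measurable fun x : X => stabilizer G x :=
    measurable_to_countable' measurableSet_stabilizer_eq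
  have hτm : Measurable fun x : X => τ (stabilizer G x) := measurable_from_top.comp hstab
  have hsmul : Measurable fun p : G × X => p.1 • p.2 :=
    measurable_from_prod_countable_right fun g => measurable_const_smul g
  refine IsHyperfinite.of_reduction (c := fun x => stabilizer G x)
    (f := fun x => τ (stabilizer G x) • x) (r := fun x => e (τ (stabilizer G x)))
    ⟨fun x => ⟨1, one_smul G x⟩, ?_, ?_⟩ measurableSet_stabilizer_eq
    (hsmul.comp (hτm.prodMk measurable_id)) (measurable_from_top.comp hτm)
    (fun x => ⟨_, rfl⟩) ?_ ?_ h
  · rintro x _ ⟨g, rfl⟩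
    exact ⟨g⁻¹, inv_smul_smul g x⟩
  · rintro x _ _ ⟨g, rfl⟩ ⟨k, rfl⟩
    exact ⟨k * g, mul_smul k g x⟩
  · rintro x _ ⟨g, rfl⟩
    simp only [stabilizer_smul_eq_stabilizer_map_conj]
    exact (hτ _ g).symm
  · intro n y
    refine (((Set.finite_Iic n).preimage he.injOn).image fun g : G => g⁻¹ • y).subset ?_
    rintro x ⟨rfl, hx⟩
    exact ⟨_, hx, inv_smul_smul _ x⟩

/-- **Corollary 7.2.** If all free Borel actions of polycyclic groups have hyperfinite orbit
equivalence relations, then all Borel actions of polycyclic groups have hyperfinite orbit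
equivalence relations. -/
theorem polycyclic_free_to_general
    (hfreecase : ∀ (G : Type) [iG : Group G], IsPolycyclic G →
      ∀ (X : Type) [mX : MeasurableSpace X], StandardBorelSpace X →
      ∀ a : G → X → X, IsGroupAction a → (∀ g, Measurable (a g)) →
      (∀ g x, a g x = x → g = 1) →
      IsHyperfinite fun x y => ∃ g, a g x = y) :
    ∀ (G : Type) [iG : Group G], IsPolycyclic G →
      ∀ (X : Type) [mX : MeasurableSpace X], StandardBorelSpace X →
      ∀ a : G → X → X, IsGroupAction a → (∀ g, Measurable (a g)) →
      IsHyperfinite fun x y => ∃ g, a g x = y := by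
  intro G _ hG X _ hX a ha hmeas
  let _ : MulAction G X := { smul := a, one_smul := ha.1, mul_smul := ha.2 }
  have _ : MeasurableConstSMul G X := ⟨hmeas⟩
  have _ := hG.countable
  have _ := hG.countable_subgroup
  exact isHyperfinite_orbit_of_countable_subgroup fun H =>
    isHyperfinite_stabilizer_eq hfreecase hG H
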